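/- arXiv:math/0508546 — 3 statements merged into one kernel-verified Lean document; each statement's English description precedes it below -/
import Mathlib

section
/- For every integer n ≥ 0, P_{n+1}(q²) = Σ_{j ∈ ℤ} (−1)^j q^{4j²} · T₁(n+1, 4j+1, q) in ℤ[q], where P_{n+1}(q²) denotes the polynomial P_{n+1} with q² substituted for q, and the sum has only finitely many nonzero terms since T₁(n+1, 4j+1, q) = 0 for |j| large. -/
open Polynomial

/-- The q-Pell polynomials: P₀ = 0, P₁ = 1, Pₙ = (1+q^(n-1)) Pₙ₋₁ + q^(n-2) Pₙ₋₂. -/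
noncomputable def qP : ℕ → Polynomial ℤ
  | 0 => 0
  | 1 => 1
  | n + 2 => (1 + X ^ (n + 1)) * qP (n + 1) + X ^ n * qP n
/-- The Gaussian (q-)binomial coefficient [n choose m]_q ∈ ℤ[q], defined via the
Pascal-type recurrence [n+1 choose m]_q = q^m [n choose m]_q + [n choose m-1]_q;
it equals ((1-q^n)⋯(1-q^(n-m+1)))/((1-q^m)⋯(1-q)) for 0 ≤ m ≤ n and is 0 for m > n. -/
noncomputable def qbinom : ℕ → ℕ → Polynomial ℤ
  | _, 0 => 1
  | 0, _ + 1 => 0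
  | n + 1, m + 1 => X ^ (m + 1) * qbinom n (m + 1) + qbinom n m
/-- The q-binomial coefficient with an integer lower index, which is 0 when that index
is negative. -/
noncomputable def qbinomZ (n : ℕ) (m : ℤ) : Polynomial ℤ :=
  if 0 ≤ m then qbinom n m.toNat else 0

/-- T₁(n, m, q) = Σ_{j=0}^n (−q)^j [n choose j]_{q²} [2n−2j choose n−m−j]_q. -/
noncomputable def qT1 (n : ℕ) (m : ℤ) : Polynomial ℤ :=
  ∑ j ∈ Finset.range (n + 1),
    (-X) ^ j * (qbinom n j).comp (X ^ 2) * qbinomZ (2 * n - 2 * j) ((n : ℤ) - m - j)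


section Helpers

variable {K : Type*} [Field K]

noncomputable def hB (q : K) : ℕ → ℤ → K
  | 0, m => if m = 0 then 1 else 0
  | n + 1, m => q ^ m * hB q n m + hB q n (m - 1)

theorem hB_neg (q : K) (n : ℕ) : ∀ m : ℤ, m < 0 → hB q n m = 0 := by
  induction n with
  | zero => intro m hm; simp [hB, hm.ne]
  | succ n ih => intro m hm; rw [hB, ih m hm, ih (m-1) (by omega)]; simp

theorem hB_gt (q : K) (n : ℕ) : ∀ m : ℤ, (n : ℤ) < m → hB q n m = 0 := by
  induction n with
  | zero => intro m hm; simp only [hB]; rw [if_neg]; simp at hm; omega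
  | succ n ih =>
    intro m hm
    push_cast at hm
    rw [hB, ih m (by omega), ih (m-1) (by omega)]; simp

theorem hB_P2 (q : K) (hq : q ≠ 0) (n : ℕ) : ∀ m : ℤ,
    hB q (n+1) m = hB q n m + q ^ ((n:ℤ) + 1 - m) * hB q n (m-1) := by
  induction n with
  | zero =>
    intro m
    simp only [hB]
    by_cases h : m = 0
    · subst h; simp
    · by_cases h1 : m = 1
      · subst h1; simp
      · have : m - 1 ≠ 0 := by omega
        simp [h, this]
  | succ n ih =>
    intro m
    rw [hB]
    have e6 : hB q (n+1) (m-1) = q^(m-1) * hB q n (m-1) + hB q n (m-1-1) := rfl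
    have e1 : q^m * q^((n:ℤ)+1-m) = q^((n:ℤ)+1) := by rw [← zpow_add₀ hq]; congr 1; ring
    have e2 : q^((n:ℤ)+1+1-m) * q^(m-1) = q^((n:ℤ)+1) := by
      rw [← zpow_add₀ hq]; congr 1; ring
    have e4 : hB q (n+1) m = q^m * hB q n m + hB q n (m-1) := rfl
    have e5 := ih m
    have e7 := ih (m-1)
    have e3 : ((n:ℤ)+1-(m-1)) = (n:ℤ)+1+1-m := by ring
    rw [e3] at e7
    push_cast
    linear_combination q^m * e5 + e7 - e4 - q^((n:ℤ)+1+1-m) * e6 + (hB q n (m-1)) * e1 - (hB q n (m-1)) * e2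

theorem hB_ratio (q : K) (hq : q ≠ 0) (n : ℕ) (m : ℤ) :
    (1 - q^m) * hB q n m = (1 - q^((n:ℤ)+1-m)) * hB q n (m-1) := by
  have h1 := hB_P2 q hq n m
  have h2 : hB q (n+1) m = q^m * hB q n m + hB q n (m-1) := rfl
  linear_combination h2 - h1

theorem hB_absB (q : K) (hq : q ≠ 0) (n : ℕ) (m : ℤ) :
    (1 - q^((n:ℤ)+1-m)) * hB q (n+1) m = (1 - q^((n:ℤ)+1)) * hB q n m := by
  have h2 : hB q (n+1) m = q^m * hB q n m + hB q n (m-1) := rfl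
  have e1 : q^((n:ℤ)+1-m) * q^m = q^((n:ℤ)+1) := by rw [← zpow_add₀ hq]; congr 1; ring
  rw [h2]
  linear_combination - hB_ratio q hq n m - hB q n m * e1

theorem hB_absA (q : K) (hq : q ≠ 0) (n : ℕ) (m : ℤ) :
    (1 - q^m) * hB q (n+1) m = (1 - q^((n:ℤ)+1)) * hB q n (m-1) := by
  have h2 := hB_P2 q hq n m
  have e1 : q^m * q^((n:ℤ)+1-m) = q^((n:ℤ)+1) := by rw [← zpow_add₀ hq]; congr 1; ring
  rw [h2]
  linear_combination hB_ratio q hq n m - hB q n (m-1) * e1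

theorem hB_symm (q : K) (hq : q ≠ 0) (n : ℕ) : ∀ m : ℤ, hB q n m = hB q n (n - m) := by
  induction n with
  | zero => intro m; simp [hB]
  | succ n ih =>
    intro m
    rw [hB_P2 q hq n m, hB, ih m, ih (m-1)]
    push_cast
    rw [show (n:ℤ) + 1 - m - 1 = n - m by ring, show (n:ℤ) - (m-1) = n + 1 - m by ring]
    ring

theorem hsumA (p : K) (n : ℕ) (F : ℕ → K) :
    ∑ j ∈ Finset.range (n+2), hB p (n+1) j * F j =
    ∑ j ∈ Finset.range (n+1), hB p n j * (p^j * F j + F (j+1)) := by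
  have h : ∀ j : ℕ, hB p (n+1) j * F j = hB p n j * (p^j * F j) + hB p n ((j:ℤ)-1) * F j := by
    intro j; rw [hB, zpow_natCast]; ring
  simp_rw [h, mul_add]
  rw [Finset.sum_add_distrib, Finset.sum_add_distrib, Finset.sum_range_succ,
    hB_gt p n ((n+1:ℕ):ℤ) (by push_cast; omega)]
  rw [Finset.sum_range_succ' (fun j : ℕ => hB p n ((j:ℤ)-1) * F j), hB_neg p n _ (by simp)]
  simp

theorem hsumB (p : K) (hp : p ≠ 0) (n : ℕ) (F : ℕ → K) :
    ∑ j ∈ Finset.range (n+2), hB p (n+1) j * F j =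
    ∑ j ∈ Finset.range (n+1), hB p n j * (F j + p^((n:ℤ)-j) * F (j+1)) := by
  have h : ∀ j : ℕ, hB p (n+1) j * F j =
      hB p n j * F j + hB p n ((j:ℤ)-1) * (p^((n:ℤ)+1-j) * F j) := by
    intro j; rw [hB_P2 p hp]; ring
  simp_rw [h, mul_add]
  rw [Finset.sum_add_distrib, Finset.sum_add_distrib, Finset.sum_range_succ,
    hB_gt p n ((n+1:ℕ):ℤ) (by push_cast; omega)]
  rw [Finset.sum_range_succ' (fun j : ℕ => hB p n ((j:ℤ)-1) * (p^((n:ℤ)+1-j) * F j)),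
    hB_neg p n _ (by simp)]
  simp

theorem hsum_absA (p : K) (hp : p ≠ 0) (n : ℕ) (F : ℕ → K) :
    ∑ j ∈ Finset.range (n+2), hB p (n+1) j * ((1 - p^j) * F j) =
    (1 - p^(n+1)) * ∑ j ∈ Finset.range (n+1), hB p n j * F (j+1) := by
  rw [Finset.sum_range_succ', Finset.mul_sum]
  simp only [pow_zero, sub_self, zero_mul, mul_zero, add_zero]
  refine Finset.sum_congr rfl fun j _ => ?_
  have := hB_absA p hp n ((j+1:ℕ):ℤ)
  rw [zpow_natCast] at this
  have e : ((j+1:ℕ):ℤ) - 1 = j := by push_cast; ring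
  rw [e] at this
  have e2 : p^((n:ℤ)+1) = p^(n+1) := by exact_mod_cast zpow_natCast p (n+1)
  rw [e2] at this
  linear_combination F (j+1) * this

theorem hsum_absB (p : K) (hp : p ≠ 0) (n : ℕ) (F : ℕ → K) :
    ∑ j ∈ Finset.range (n+2), hB p (n+1) j * ((1 - p^((n:ℤ)+1-j)) * F j) =
    (1 - p^(n+1)) * ∑ j ∈ Finset.range (n+1), hB p n j * F j := by
  rw [Finset.sum_range_succ, Finset.mul_sum]
  have e0 : (n:ℤ) + 1 - ((n+1:ℕ):ℤ) = 0 := by push_cast; ring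
  rw [e0]
  simp only [zpow_zero, sub_self, zero_mul, mul_zero, add_zero]
  refine Finset.sum_congr rfl fun j _ => ?_
  have := hB_absB p hp n j
  have e2 : p^((n:ℤ)+1) = p^(n+1) := by exact_mod_cast zpow_natCast p (n+1)
  rw [e2] at this
  linear_combination F j * this

noncomputable def hT (q : K) (c n : ℕ) (m : ℤ) : K :=
  ∑ j ∈ Finset.range (n+1), hB (q^2) n j * ((-1)^j * q^(c*j) * hB q (2*(n-j)) ((n:ℤ)-m-j))

theorem hT_symm (q : K) (hq : q ≠ 0) (c n : ℕ) (m : ℤ) : hT q c n (-m) = hT q c n m := by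
  unfold hT
  refine Finset.sum_congr rfl fun j hj => ?_
  obtain ⟨N, rfl⟩ := Nat.exists_eq_add_of_le (Finset.mem_range_succ_iff.mp hj)
  rw [hB_symm q hq _ (_ - m - _)]
  congr 3
  simp only [Nat.add_sub_cancel_left]
  push_cast
  ring

theorem hT_zero (q : K) (c n : ℕ) (m : ℤ) (h : (n:ℤ) < m ∨ m < -n) : hT q c n m = 0 := by
  unfold hT
  refine Finset.sum_eq_zero fun j hj => ?_
  obtain ⟨N, rfl⟩ := Nat.exists_eq_add_of_le (Finset.mem_range_succ_iff.mp hj)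
  rcases h with h | h
  · rw [hB_neg q (2 * _)]; · simp
    push_cast at *; omega
  · rw [hB_gt q (2 * _)]; · simp
    simp only [Nat.add_sub_cancel_left]
    push_cast at *; omega

theorem hT1_rec (q : K) (hq : q ≠ 0) (n : ℕ) (A : ℤ) :
    hT q 1 (n+1) A = hT q 1 n A + q^((n:ℤ)+1+A) * hT q 0 n (A+1)
      + q^((n:ℤ)+1-A) * hT q 0 n (A-1) := by
  unfold hT
  rw [hsumB _ (pow_ne_zero 2 hq), Finset.mul_sum, Finset.mul_sum, ← Finset.sum_add_distrib,
    ← Finset.sum_add_distrib]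
  refine Finset.sum_congr rfl fun j hj => ?_
  obtain ⟨N, rfl⟩ := Nat.exists_eq_add_of_le (Finset.mem_range_succ_iff.mp hj)
  rw [show j + N + 1 - j = N + 1 by omega, show j + N + 1 - (j+1) = N by omega,
    show j + N - j = N by omega]
  rw [show 2 * (N+1) = 2*N+1+1 by ring]
  have h1 := hB_P2 q hq (2*N) ((N:ℤ)-A)
  have h2 := hB_P2 q hq (2*N) ((N:ℤ)-A+1)
  have h3 : hB q (2*N+1+1) ((N:ℤ)-A+1) = q^((N:ℤ)-A+1) * hB q (2*N+1) ((N:ℤ)-A+1)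
     + hB q (2*N+1) ((N:ℤ)-A+1-1) := rfl
  push_cast at *
  rw [show ((j:ℤ)+N+1-A-j) = (N:ℤ)-A+1 by ring, show ((j:ℤ)+N+1-A-(j+1)) = (N:ℤ)-A by ring,
    show ((j:ℤ)+N-A-j) = (N:ℤ)-A by ring, show ((j:ℤ)+N-(A+1)-j) = (N:ℤ)-A-1 by ring,
    show ((j:ℤ)+N-(A-1)-j) = (N:ℤ)-A+1 by ring, show (j:ℤ)+N-j = N by ring]
  rw [h3, add_sub_cancel_right, h2, h1, add_sub_cancel_right]
  generalize hB q (2*N) ((N:ℤ)-A) = x2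
  generalize hB q (2*N) ((N:ℤ)-A-1) = x3
  generalize hB q (2*N) ((N:ℤ)-A+1) = x1
  generalize hB (q^2) (j+N) j = y
  rw [show (2*(N:ℤ)+1-((N:ℤ)-A+1)) = N + A by ring, show (2*(N:ℤ)+1-((N:ℤ)-A)) = N + A + 1 by ring]
  have hA := zpow_ne_zero A hq
  simp only [zpow_add₀ hq, zpow_sub₀ hq, zpow_natCast, zpow_one]
  field_simp
  ring

theorem hR (q : K) (hq : q ≠ 0) (n : ℕ) (A : ℤ) :
    hT q 2 n (A-1) - hT q 0 n (A-1) + q^((n:ℤ)+A) * hT q 1 n A - hT q 0 n A = 0 := by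
  rcases n with _ | n
  · simp only [hT, hB]
    by_cases h : A = 0
    · subst h; simp
    · simp
      simp [hB, h]
  · have hp := pow_ne_zero 2 hq
    have hA := zpow_ne_zero A hq
    have key : hT q 2 (n+1) (A-1) - hT q 0 (n+1) (A-1) + q^(((n+1:ℕ):ℤ)+A) * hT q 1 (n+1) A
        - hT q 0 (n+1) A =
        - (∑ j ∈ Finset.range (n+2), hB (q^2) (n+1) j * ((1 - (q^2)^j) *
            ((-1)^j * hB q (2*(n+1-j)+1) ((n:ℤ)+1-A-j+1))))
        - ∑ j ∈ Finset.range (n+2), hB (q^2) (n+1) j * ((1 - (q^2)^((n:ℤ)+1-j)) *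
            ((-1)^j * hB q (2*(n-j)+1) ((n:ℤ)+1-A-j))) := by
      unfold hT
      rw [Finset.mul_sum, ← Finset.sum_sub_distrib, ← Finset.sum_add_distrib,
        ← Finset.sum_sub_distrib, ← Finset.sum_neg_distrib, ← Finset.sum_sub_distrib]
      refine Finset.sum_congr rfl fun j hj => ?_
      have hj' := Finset.mem_range_succ_iff.mp hj
      have e1 : (1 - (q^2)^((n:ℤ)+1-j)) * hB q (2*(n-j)+1) ((n:ℤ)+1-A-j)
         = (1 - q^((n:ℤ)+1-j+A)) * hB q (2*(n+1-j)) ((n:ℤ)+1-A-j) := by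
        rcases Nat.lt_or_ge n j with h | h
        · obtain rfl : j = n + 1 := by omega
          simp only [Nat.sub_self, mul_zero, hB]
          push_cast
          rw [show (n:ℤ)+1-((n:ℤ)+1) = 0 by ring, show (n:ℤ)+1-A-((n:ℤ)+1) = -A by ring]
          by_cases h : A = 0
          · subst h; simp
          · simp [h]
        · obtain ⟨N, rfl⟩ := Nat.exists_eq_add_of_le h
          rw [show j + N + 1 - j = N + 1 by omega, show j + N - j = N by omega,
            show 2*(N+1) = 2*N+1+1 by ring]
          push_cast
          have := hB_absB q hq (2*N+1) ((j:ℤ)+N+1-A-j)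
          push_cast at this
          rw [show 2*(N:ℤ)+1+1-((j:ℤ)+N+1-A-j) = (j:ℤ)+N+1-j+A by ring] at this
          rw [this]
          congr 2
          rw [← zpow_natCast q 2, ← zpow_mul]
          congr 1
          push_cast; ring
      obtain ⟨N, hN⟩ := Nat.exists_eq_add_of_le hj'
      have hN' : (n:ℤ) + 1 = j + N := by exact_mod_cast hN
      have e2 := hB_P2 q hq (2*(n+1-j)) ((n:ℤ)+1-A-j+1)
      rw [e2]
      have e3 : n + 1 - j = N := by omega
      rw [e3] at e1 ⊢
      push_cast
      rw [hN'] at e1 ⊢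
      rw [show ((j:ℤ)+N-(A-1)-j) = (N:ℤ)-A+1 by ring]
      rw [show ((j:ℤ)+N-A-j) = (N:ℤ)-A by ring] at e1 ⊢
      rw [add_sub_cancel_right]
      rw [show (2*(N:ℤ)+1-((N:ℤ)-A+1)) = N + A by ring]
      rw [show (j:ℤ)+N-j = N by ring] at e1 ⊢
      generalize hB q (2*N) ((N:ℤ)-A) = x2 at *
      generalize hB q (2*N) ((N:ℤ)-A+1) = x1 at *
      generalize hB (q^2) (n+1) j = y at *
      clear e2
      generalize hB q (2*(n-j)+1) ((N:ℤ)-A) = z at e1 ⊢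
      simp only [zpow_add₀ hq, zpow_natCast] at e1 ⊢
      linear_combination y * (-1)^j * e1
    rw [key, hsum_absA _ hp, hsum_absB _ hp]
    rw [← mul_neg, ← mul_sub, ← Finset.sum_neg_distrib, ← Finset.sum_sub_distrib]
    refine mul_eq_zero_of_right _ (Finset.sum_eq_zero fun j hj => ?_)
    rw [show n + 1 - (j+1) = n - j by omega]
    push_cast
    rw [show (n:ℤ)+1-A-(j+1)+1 = (n:ℤ)+1-A-j by ring]
    ring

theorem hT0_rec (q : K) (hq : q ≠ 0) (n : ℕ) (A : ℤ) :
    hT q 0 (n+1) A = hT q 0 n (A-1) + q^((n:ℤ)+1+A) * hT q 1 n A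
      + q^(2*((n:ℤ)+1+A)) * hT q 0 n (A+1) := by
  have hr := hR q hq n A
  suffices h : hT q 0 (n+1) A = hT q 2 n (A-1) + q^((n:ℤ)+A) * hT q 1 n A - hT q 0 n A
      + q^((n:ℤ)+1+A) * hT q 1 n A + q^(2*((n:ℤ)+1+A)) * hT q 0 n (A+1) by
    linear_combination h + hr
  clear hr
  unfold hT
  rw [hsumA, Finset.mul_sum, Finset.mul_sum, Finset.mul_sum, ← Finset.sum_add_distrib,
    ← Finset.sum_sub_distrib, ← Finset.sum_add_distrib, ← Finset.sum_add_distrib]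
  refine Finset.sum_congr rfl fun j hj => ?_
  obtain ⟨N, rfl⟩ := Nat.exists_eq_add_of_le (Finset.mem_range_succ_iff.mp hj)
  rw [show j + N + 1 - j = N + 1 by omega, show j + N + 1 - (j+1) = N by omega,
    show j + N - j = N by omega]
  rw [show 2 * (N+1) = 2*N+1+1 by ring]
  have h1 := hB_P2 q hq (2*N) ((N:ℤ)-A)
  have h2 := hB_P2 q hq (2*N) ((N:ℤ)-A+1)
  have h3 := hB_P2 q hq (2*N+1) ((N:ℤ)-A+1)
  push_cast at *
  rw [show ((j:ℤ)+N+1-A-j) = (N:ℤ)-A+1 by ring, show ((j:ℤ)+N+1-A-(j+1)) = (N:ℤ)-A by ring,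
    show ((j:ℤ)+N-A-j) = (N:ℤ)-A by ring, show ((j:ℤ)+N-(A+1)-j) = (N:ℤ)-A-1 by ring,
    show ((j:ℤ)+N-(A-1)-j) = (N:ℤ)-A+1 by ring]
  rw [h3, add_sub_cancel_right, h2, h1, add_sub_cancel_right]
  generalize hB q (2*N) ((N:ℤ)-A) = x2
  generalize hB q (2*N) ((N:ℤ)-A-1) = x3
  generalize hB q (2*N) ((N:ℤ)-A+1) = x1
  generalize hB (q^2) (j+N) j = y
  rw [show (2*(N:ℤ)+1-((N:ℤ)-A+1)) = N + A by ring, show (2*(N:ℤ)+1-((N:ℤ)-A)) = N + A + 1 by ring,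
    show (2*(N:ℤ)+1+1-((N:ℤ)-A+1)) = N + A + 1 by ring,
    show 2*((j:ℤ)+N+1+A) = j+N+1+A+(j+N+1+A) by ring]
  have hA := zpow_ne_zero A hq
  simp only [zpow_add₀ hq, zpow_sub₀ hq, zpow_natCast, zpow_one]
  ring

/-- generic alternating sum -/
noncomputable def hS (q : K) (e : ℤ → ℤ) (c n : ℕ) (a : ℤ) : K :=
  ∑ᶠ j : ℤ, (-1:K)^j * q^(e j) * hT q c n (4*j+a)

theorem hT_fin (q : K) (g : ℤ → K) (c n : ℕ) (a : ℤ) :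
    (Function.support fun j : ℤ => g j * hT q c n (4*j+a)).Finite := by
  refine (Set.finite_Icc (-(n:ℤ) - |a|) (n + |a|)).subset fun j hj => ?_
  by_contra h
  apply hj
  have := abs_le.mp (le_refl |a|)
  simp only [Set.mem_Icc, not_and_or, not_le] at h
  simp only
  rw [hT_zero, mul_zero]
  have h0 := abs_nonneg a
  rcases h with h | h
  · right; omega
  · left; omega

theorem hS_lin (q : K) (g1 g2 g3 : ℤ → K) (c1 c2 c3 n : ℕ) (a1 a2 a3 : ℤ) :
    ∑ᶠ j : ℤ, (g1 j * hT q c1 n (4*j+a1) + g2 j * hT q c2 n (4*j+a2) + g3 j * hT q c3 n (4*j+a3))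
    = ∑ᶠ j : ℤ, g1 j * hT q c1 n (4*j+a1) + ∑ᶠ j : ℤ, g2 j * hT q c2 n (4*j+a2)
      + ∑ᶠ j : ℤ, g3 j * hT q c3 n (4*j+a3) := by
  rw [finsum_add_distrib _ (hT_fin q g3 c3 n a3), finsum_add_distrib (hT_fin q g1 c1 n a1)
    (hT_fin q g2 c2 n a2)]
  exact ((hT_fin q g1 c1 n a1).union (hT_fin q g2 c2 n a2)).subset (Function.support_add _ _)

/-- reflection `j ↦ k - j` -/
theorem hS_refl (q : K) (hq : q ≠ 0) (e e' : ℤ → ℤ) (c n : ℕ) (a a' k : ℤ)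
    (he : ∀ j, e (k - j) = e' j) (ha : a' = -4*k - a) :
    hS q e c n a = (-1)^k * hS q e' c n a' := by
  unfold hS
  rw [← finsum_comp_equiv (Equiv.subLeft k), mul_finsum]
  · refine finsum_congr fun j => ?_
    simp only [Equiv.subLeft_apply]
    rw [he, ← hT_symm q hq, show -(4*(k-j)+a) = 4*j+a' by rw [ha]; ring]
    have : (-1:K)^(k-j) = (-1)^k * (-1)^j := by
      rw [zpow_sub₀ (by simp), div_eq_mul_inv, ← inv_zpow]; norm_num
    rw [this]; ring

theorem hS_shift (q : K) (e e' : ℤ → ℤ) (c n : ℕ) (a a' k : ℤ)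
    (he : ∀ j, e (j + k) = e' j) (ha : a' = 4*k + a) :
    hS q e c n a = (-1)^k * hS q e' c n a' := by
  unfold hS
  rw [← finsum_comp_equiv (Equiv.addRight k), mul_finsum]
  · refine finsum_congr fun j => ?_
    simp only [Equiv.coe_addRight]
    rw [he, show (4*(j+k)+a) = 4*j+a' by rw [ha]; ring, zpow_add₀ (by simp)]
    ring

theorem hS1_rec (q : K) (hq : q ≠ 0) (e : ℤ → ℤ) (n : ℕ) (a : ℤ) :
    hS q e 1 (n+1) a = hS q e 1 n a
      + q^((n:ℤ)+1+a) * hS q (fun j => e j + 4*j) 0 n (a+1)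
      + q^((n:ℤ)+1-a) * hS q (fun j => e j - 4*j) 0 n (a-1) := by
  unfold hS
  rw [mul_finsum, mul_finsum]
  simp only [← mul_assoc]
  rw [← hS_lin]
  refine finsum_congr fun j => ?_
  rw [hT1_rec q hq, show 4*j+a+1 = 4*j+(a+1) by ring, show 4*j+a-1 = 4*j+(a-1) by ring,
    show (n:ℤ)+1+(4*j+a) = (n+1+a) + 4*j by ring, show (n:ℤ)+1-(4*j+a) = (n+1-a) - 4*j by ring,
    zpow_add₀ hq _ (4*j), zpow_add₀ hq (e j) (4*j), zpow_sub₀ hq _ (4*j), zpow_sub₀ hq (e j) (4*j)]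
  ring

theorem hS0_rec (q : K) (hq : q ≠ 0) (e : ℤ → ℤ) (n : ℕ) (a : ℤ) :
    hS q e 0 (n+1) a = hS q e 0 n (a-1)
      + q^((n:ℤ)+1+a) * hS q (fun j => e j + 4*j) 1 n a
      + q^(2*((n:ℤ)+1+a)) * hS q (fun j => e j + 8*j) 0 n (a+1) := by
  unfold hS
  rw [mul_finsum, mul_finsum]
  simp only [← mul_assoc]
  rw [← hS_lin]
  refine finsum_congr fun j => ?_
  rw [hT0_rec q hq, show 4*j+a+1 = 4*j+(a+1) by ring, show 4*j+a-1 = 4*j+(a-1) by ring,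
    show (n:ℤ)+1+(4*j+a) = (n+1+a) + 4*j by ring,
    show 2*((n:ℤ)+1+a+4*j) = 2*(n+1+a) + 8*j by ring,
    zpow_add₀ hq _ (4*j), zpow_add₀ hq (e j) (4*j), zpow_add₀ hq _ (8*j), zpow_add₀ hq (e j) (8*j)]
  ring

end Helpers

section Pell

variable {K : Type*} [Field K] [CharZero K]

theorem hZ1 (q : K) (hq : q ≠ 0) (n : ℕ) : hS q (fun j => 4*j^2+4*j) 0 n 2 = 0 := by
  have := hS_refl q hq (fun j => 4*j^2+4*j) (fun j => 4*j^2+4*j) 0 n 2 2 (-1)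
    (by intro j; ring) (by norm_num)
  have h1 : (-1:K)^(-1:ℤ) = -1 := by norm_num
  rw [h1, neg_one_mul] at this
  exact self_eq_neg.mp this

theorem hZ2 (q : K) (hq : q ≠ 0) (n : ℕ) : hS q (fun j => 4*j^2-4*j) 0 n (-2) = 0 := by
  have := hS_refl q hq (fun j => 4*j^2-4*j) (fun j => 4*j^2-4*j) 0 n (-2) (-2) 1
    (by intro j; ring) (by norm_num)
  rw [zpow_one, neg_one_mul] at this
  exact self_eq_neg.mp this

theorem hSr (q : K) (hq : q ≠ 0) (n : ℕ) :
    hS q (fun j => 4*j^2) 1 (n+1) 1 = hS q (fun j => 4*j^2) 1 n 1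
      + q^n * hS q (fun j => 4*j^2-4*j) 0 n 0 := by
  rw [hS1_rec q hq]
  have h := hZ1 q hq n
  rw [show (1:ℤ)+1 = 2 by norm_num, h, sub_self, add_sub_cancel_right, zpow_natCast]
  ring

theorem hWr (q : K) (hq : q ≠ 0) (n : ℕ) :
    hS q (fun j => 4*j^2-4*j) 0 (n+1) (-1) = q^n * hS q (fun j => 4*j^2) 1 n 1
      + q^(2*n) * hS q (fun j => 4*j^2-4*j) 0 n 0 := by
  rw [hS0_rec q hq]
  have h1 := hS_refl q hq (fun j => 4*j^2-4*j+4*j) (fun j => 4*j^2) 1 n (-1) 1 0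
    (by intro j; ring) (by norm_num)
  have h2 := hS_refl q hq (fun j => 4*j^2-4*j+8*j) (fun j => 4*j^2-4*j) 0 n 0 0 0
    (by intro j; ring) (by norm_num)
  have h3 := hZ2 q hq n
  rw [zpow_zero, one_mul] at h1 h2
  rw [show (-1:ℤ)-1 = -2 by norm_num, show (-1:ℤ)+1 = 0 by norm_num, h1, h2, h3,
    show (n:ℤ)+1+-1 = n by ring, zpow_natCast, show 2*(n:ℤ) = ((2*n:ℕ):ℤ) by push_cast; ring,
    zpow_natCast, zero_add]

theorem hUr (q : K) (hq : q ≠ 0) (n : ℕ) :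
    hS q (fun j => 4*j^2-4*j) 0 (n+1) 0 =
      (1 + q^(2*n+2)) * hS q (fun j => 4*j^2-4*j) 0 n (-1)
      + q^(n+1) * hS q (fun j => 4*j^2) 1 n 0 := by
  rw [hS0_rec q hq]
  have h1 : (fun j : ℤ => 4*j^2-4*j+4*j) = (fun j => 4*j^2) := by funext j; ring
  have h2 := hS_refl q hq (fun j => 4*j^2-4*j+8*j) (fun j => 4*j^2-4*j) 0 n 1 (-1) 0
    (by intro j; ring) (by norm_num)
  rw [zpow_zero, one_mul] at h2
  rw [show (0:ℤ)-1 = -1 by norm_num, show (0:ℤ)+1 = 1 by norm_num, h1, h2,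
    show (n:ℤ)+1+0 = ((n+1:ℕ):ℤ) by push_cast; ring, zpow_natCast,
    show 2*((n+1:ℕ):ℤ) = ((2*n+2:ℕ):ℤ) by push_cast; ring,
    zpow_natCast]
  ring

theorem hVr (q : K) (hq : q ≠ 0) (n : ℕ) :
    hS q (fun j => 4*j^2) 1 (n+1) 0 = hS q (fun j => 4*j^2) 1 n 0
      + 2 * q^(n+1) * hS q (fun j => 4*j^2-4*j) 0 n (-1) := by
  rw [hS1_rec q hq]
  have h2 := hS_refl q hq (fun j => 4*j^2+4*j) (fun j => 4*j^2-4*j) 0 n 1 (-1) 0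
    (by intro j; ring) (by norm_num)
  rw [zpow_zero, one_mul] at h2
  rw [show (0:ℤ)-1 = -1 by norm_num, show (0:ℤ)+1 = 1 by norm_num, h2,
    show (n:ℤ)+1+0 = ((n+1:ℕ):ℤ) by push_cast; ring, zpow_natCast,
    show (n:ℤ)+1-0 = ((n+1:ℕ):ℤ) by push_cast; ring, zpow_natCast]
  ring

theorem hT_base (q : K) (c : ℕ) (m : ℤ) : hT q c 0 m = if m = 0 then 1 else 0 := by
  simp [hT]
  simp [hB]

theorem hS_base0 (q : K) (e : ℤ → ℤ) (c : ℕ) (a : ℤ) (h : ∀ j : ℤ, 4*j+a ≠ 0) :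
    hS q e c 0 a = 0 := by
  unfold hS
  rw [← finsum_zero (M := K) (α := ℤ)]
  refine finsum_congr fun j => ?_
  rw [hT_base, if_neg (h j), mul_zero]

theorem hS_base1 (q : K) (e : ℤ → ℤ) (c : ℕ) (he : e 0 = 0) :
    hS q e c 0 0 = 1 := by
  unfold hS
  rw [finsum_eq_single _ 0]
  · simp [hT_base, he]
  · intro j hj
    rw [hT_base, if_neg (by omega), mul_zero]

theorem hpell (q : K) (hq : q ≠ 0) (n : ℕ) :
    hS q (fun j => 4*j^2) 1 (n+2) 1 = (1 + q^(2*n+2)) * hS q (fun j => 4*j^2) 1 (n+1) 1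
      + q^(2*n) * hS q (fun j => 4*j^2) 1 n 1 ∧
    hS q (fun j => 4*j^2) 1 (n+1) 0 = hS q (fun j => 4*j^2) 1 (n+1) 1
      + q^(2*n) * hS q (fun j => 4*j^2) 1 n 1 := by
  have s1 := hSr q hq
  have w1 := hWr q hq
  have u1 := hUr q hq
  have v1 := hVr q hq
  have s0 : hS q (fun j => 4*j^2) 1 0 1 = 0 := hS_base0 _ _ _ _ (by intro j; omega)
  have w0 : hS q (fun j => 4*j^2-4*j) 0 0 (-1) = 0 := hS_base0 _ _ _ _ (by intro j; omega)
  have u0 : hS q (fun j => 4*j^2-4*j) 0 0 0 = 1 := hS_base1 _ _ _ (by simp)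
  have v0 : hS q (fun j => 4*j^2) 1 0 0 = 1 := hS_base1 _ _ _ (by simp)
  induction n with
  | zero =>
    rw [s1 1, u1 0, v1 0, s1 0, s0, w0, u0, v0]
    constructor <;> ring
  | succ n ih =>
    obtain ⟨i1, i2⟩ := ih
    have hw : hS q (fun j => 4*j^2-4*j) 0 (n+1) (-1)
        = q^n * hS q (fun j => 4*j^2) 1 (n+1) 1 := by
      rw [w1, s1]; ring
    constructor
    · rw [s1 (n+1+1), u1 (n+1), hw, i2]
      linear_combination (-q^(2*n+4)) * i1
    · rw [v1 (n+1), hw, i2, i1]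
      ring

end Pell

section Bridge

variable {K : Type*} [Field K]

theorem hB_at0 (q : K) (n : ℕ) : hB q n 0 = 1 := by
  induction n with
  | zero => simp [hB]
  | succ n ih => rw [hB, ih, hB_neg q n _ (by norm_num)]; simp

theorem hbr (φ : ℤ[X] →+* K) (n : ℕ) : ∀ m : ℕ, φ (qbinom n m) = hB (φ X) n m := by
  induction n with
  | zero =>
    intro m
    rcases m with _ | m
    · simp [qbinom, hB]
    · simp [qbinom, hB]; intro h; omega
  | succ n ih =>
    intro m
    rcases m with _ | m
    · rw [Nat.cast_zero, hB_at0]; simp [qbinom]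
    · rw [qbinom, hB, map_add, map_mul, map_pow, ih, ih, zpow_natCast]
      congr 2
      push_cast; ring

theorem hbrZ (φ : ℤ[X] →+* K) (n : ℕ) (m : ℤ) : φ (qbinomZ n m) = hB (φ X) n m := by
  unfold qbinomZ
  split_ifs with h
  · rw [hbr, Int.toNat_of_nonneg h]
  · rw [map_zero, hB_neg _ _ _ (by omega)]

theorem hbrc (φ : ℤ[X] →+* K) (n m : ℕ) :
    φ ((qbinom n m).comp (X^2)) = hB ((φ X)^2) n m := by
  have := hbr (φ.comp (compRingHom (X^2))) n m
  simpa using this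

theorem hbrT (φ : ℤ[X] →+* K) (n : ℕ) (m : ℤ) : φ (qT1 n m) = hT (φ X) 1 n m := by
  unfold qT1 hT
  rw [map_sum]
  refine Finset.sum_congr rfl fun j _ => ?_
  rw [map_mul, map_mul, hbrc, hbrZ, map_pow, map_neg, neg_pow, one_mul, Nat.mul_sub]
  ring

theorem hbrP [CharZero K] (φ : ℤ[X] →+* K) (hq : φ X ≠ 0) (n : ℕ) :
    φ ((qP n).comp (X^2)) = hS (φ X) (fun j => 4*j^2) 1 n 1 := by
  have s0 : hS (φ X) (fun j => 4*j^2) 1 0 1 = 0 := hS_base0 _ _ _ _ (by intro j; omega)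
  induction n using Nat.twoStepInduction with
  | zero => rw [s0]; simp [qP]
  | one =>
    rw [hSr _ hq 0, s0, hS_base1 _ _ _ (by simp)]; simp [qP]
  | more n h1 h2 =>
    rw [(hpell _ hq n).1, ← h1, ← h2, qP]
    simp
    ring

end Bridge

/-- For n ≥ 0, P_{n+1}(q²) = Σ_{j ∈ ℤ} (−1)^j q^(4j²) T₁(n+1, 4j+1, q),
the sum having finitely many nonzero terms. -/
theorem qPell_T1_formula (n : ℕ) :
    (qP (n + 1)).comp (X ^ 2) =
      ∑ᶠ j : ℤ, C ((j.negOnePow : ℤˣ) : ℤ) * X ^ (4 * j ^ 2).toNat *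
        qT1 (n + 1) (4 * j + 1) := by
  let φ : ℤ[X] →+* FractionRing ℤ[X] := algebraMap _ _
  have hφ : Function.Injective φ := IsFractionRing.injective _ _
  have : CharZero (FractionRing ℤ[X]) := charZero_of_injective_ringHom hφ
  have hq : φ X ≠ 0 := (map_ne_zero_iff φ hφ).mpr X_ne_zero
  apply hφ
  rw [hbrP φ hq]
  have hm := AddMonoidHom.map_finsum_of_injective (φ : ℤ[X] →+ FractionRing ℤ[X]) hφ
    (fun j : ℤ => C ((j.negOnePow : ℤˣ) : ℤ) * X ^ (4 * j ^ 2).toNat *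
        qT1 (n + 1) (4 * j + 1))
  refine Eq.trans ?_ hm.symm
  unfold hS
  refine finsum_congr fun j => ?_
  change _ = φ (C ((j.negOnePow : ℤˣ) : ℤ) * X ^ (4 * j ^ 2).toNat * qT1 (n + 1) (4 * j + 1))
  rw [map_mul, map_mul, hbrT, map_pow]
  congr 2
  · rcases Int.even_or_odd j with h | h
    · rw [h.neg_one_zpow, Int.negOnePow_even _ h]; simp
    · rw [h.neg_one_zpow, Int.negOnePow_odd _ h]; simp
  · rw [← zpow_natCast, Int.toNat_of_nonneg (by positivity)]
end

section
/- For every integer n ≥ 0, P̂_{n+1}(q) = Σ_{j=0}^{n} Σ_{k=0}^{j} q^{(j²+j+k²+k)/2} · [j choose k]_q · [n−k choose j]_q in ℤ[q]. -/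
open Polynomial

/-- The q-Pell polynomials: P̂₀ = 0, P̂₁ = 1, P̂ₙ = (1+q^(n-1)) P̂ₙ₋₁ + q^(n-1) P̂ₙ₋₂. -/
noncomputable def qPhat : ℕ → Polynomial ℤ
  | 0 => 0
  | 1 => 1
  | n + 2 => (1 + X ^ (n + 1)) * qPhat (n + 1) + X ^ (n + 1) * qPhat n
lemma qb_zero_right (n : ℕ) : qbinom n 0 = 1 := by cases n <;> simp [qbinom]

lemma qb_succ (n m : ℕ) :
    qbinom (n + 1) (m + 1) = X ^ (m + 1) * qbinom n (m + 1) + qbinom n m := by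
  simp [qbinom]

lemma qb_eq_zero : ∀ (n m : ℕ), n < m → qbinom n m = 0
  | n, 0, h => by omega
  | 0, m + 1, _ => by simp [qbinom]
  | n + 1, m + 1, h => by
    rw [qb_succ, qb_eq_zero n (m + 1) (by omega), qb_eq_zero n m (by omega)]; simp

lemma qb_succ' : ∀ (n m : ℕ),
    qbinom (n + 1) (m + 1) = qbinom n (m + 1) + X ^ (n - m) * qbinom n m
  | 0, 0 => by simp [qbinom]
  | 0, m + 1 => by simp [qbinom]
  | n + 1, 0 => by
    have h3 := qb_succ' n 0
    have h4 := qb_succ n 0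
    rw [qb_succ (n + 1) 0]
    simp only [qb_zero_right, Nat.sub_zero] at *
    linear_combination X * h3 - h4
  | n + 1, m + 1 => by
    have h1 := qb_succ' n m
    have h2 := qb_succ n m
    have h3 := qb_succ' n (m + 1)
    have h4 := qb_succ n (m + 1)
    rw [qb_succ (n + 1) (m + 1)]
    have e : n + 1 - (m + 1) = n - m := by omega
    rw [e]
    by_cases h : m + 1 ≤ n
    · obtain ⟨d, rfl⟩ := Nat.exists_eq_add_of_le h
      have e1 : m + 1 + d - (m + 1) = d := by omega
      have e2 : m + 1 + d - m = d + 1 := by omega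
      rw [e1] at h3
      rw [e2] at h1 ⊢
      linear_combination X ^ (m + 2) * h3 - h4 + h1 - X ^ (d + 1) * h2
    · have h0 : qbinom n (m + 1) = 0 := qb_eq_zero _ _ (by omega)
      rw [h0] at h1 h2 h3 h4
      linear_combination X ^ (m + 2) * h3 - h4 + h1 - X ^ (n - m) * h2

noncomputable def pT (n j k : ℕ) : Polynomial ℤ :=
  X ^ ((j + 1).choose 2 + (k + 1).choose 2) * qbinom j k * qbinom (n - k) j

noncomputable def pU (n j k : ℕ) : Polynomial ℤ :=
  X ^ ((j + 1).choose 2 + k.choose 2) * qbinom (j + 1) k * qbinom (n - k) j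

lemma ch2 (j : ℕ) : (j + 1).choose 2 = j + j.choose 2 := by
  rw [Nat.choose_succ_succ' j 1]; simp

lemma pT_zero (n j k : ℕ) (h : n < j ∨ j < k) : pT n j k = 0 := by
  unfold pT
  rcases h with h | h
  · rw [qb_eq_zero (n - k) j (by omega)]; simp
  · rw [qb_eq_zero j k h]; simp

lemma pT_succ (n j k : ℕ) (hn : 1 ≤ n) :
    pT (n + 1) (j + 1) k = pT n (j + 1) k + X ^ (n + 1) * pU n j k := by
  by_cases hk : k ≤ n
  · unfold pT pU
    have e : n + 1 - k = (n - k) + 1 := by omega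
    rw [e, qb_succ']
    by_cases hj : j ≤ n - k
    · have e2 : (j + 1 + 1).choose 2 + (k + 1).choose 2 + (n - k - j)
          = n + 1 + ((j + 1).choose 2 + k.choose 2) := by
        rw [ch2 (j + 1), ch2 k]; omega
      have e3 := congrArg (fun t => (X : Polynomial ℤ) ^ t) e2
      simp only [pow_add _ (_ + _) (n - k - j), pow_add _ (n + 1) _] at e3
      linear_combination (qbinom (j + 1) k * qbinom (n - k) j) * e3
    · rw [qb_eq_zero (n - k) j (by omega)]; ring
  · have hU : pU n j k = 0 := by
      unfold pU
      by_cases hj : j = 0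
      · subst hj
        rw [qb_eq_zero (0 + 1) k (by omega)]; simp
      · rw [qb_eq_zero (n - k) j (by omega)]; simp
    rw [hU]
    have h1 : pT (n + 1) (j + 1) k = 0 := by
      unfold pT; rw [qb_eq_zero (n + 1 - k) (j + 1) (by omega)]; simp
    have h2 : pT n (j + 1) k = 0 := by
      unfold pT; rw [qb_eq_zero (n - k) (j + 1) (by omega)]; simp
    rw [h1, h2]; simp

lemma pU_zero (n j : ℕ) : pU n j 0 = pT n j 0 := by
  simp [pU, pT, qb_zero_right]

lemma pU_succ (n j k : ℕ) : pU (n + 1) j (k + 1) = pT (n + 1) j (k + 1) + pT n j k := by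
  unfold pU pT
  rw [qb_succ, ch2 (k + 1), Nat.add_sub_add_right]
  ring

noncomputable def pS (J K n : ℕ) : Polynomial ℤ :=
  ∑ j ∈ Finset.range J, ∑ k ∈ Finset.range K, pT n j k

lemma pS_rec (N K n : ℕ) : pS (N + 1) (K + 1) (n + 2) =
    pS (N + 1) (K + 1) (n + 1) + X ^ (n + 2) * (pS N (K + 1) (n + 1) + pS N K n) := by
  have h0 : ∀ k, pT (n + 2) 0 k = pT (n + 1) 0 k := by
    intro k; simp [pT, qb_zero_right]
  have hU : ∀ j, ∑ k ∈ Finset.range (K + 1), pU (n + 1) j k =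
      ∑ k ∈ Finset.range (K + 1), pT (n + 1) j k + ∑ k ∈ Finset.range K, pT n j k := by
    intro j
    rw [Finset.sum_range_succ', Finset.sum_range_succ' (fun k => pT (n + 1) j k)]
    simp only [pU_succ, pU_zero, Finset.sum_add_distrib]
    ring
  unfold pS
  rw [Finset.sum_range_succ', Finset.sum_range_succ' (fun j => ∑ k ∈ Finset.range (K + 1), pT (n + 1) j k)]
  simp only [h0, pT_succ (n + 1) _ _ (Nat.le_add_left 1 n), Finset.sum_add_distrib, ← Finset.mul_sum, hU]
  ring

lemma pS_stable (J K n : ℕ) (hJ : n < J) (hK : n < K) : pS J K n =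
    ∑ j ∈ Finset.range (n + 1), ∑ k ∈ Finset.range (j + 1), pT n j k := by
  unfold pS
  symm
  have h1 : ∑ j ∈ Finset.range (n + 1), ∑ k ∈ Finset.range (j + 1), pT n j k =
      ∑ j ∈ Finset.range (n + 1), ∑ k ∈ Finset.range K, pT n j k := by
    refine Finset.sum_congr rfl fun j hj => ?_
    rw [Finset.mem_range] at hj
    refine Finset.sum_subset (Finset.range_subset_range.2 (by omega)) fun k _ hk => ?_
    rw [Finset.mem_range] at hk
    exact pT_zero _ _ _ (by omega)
  rw [h1]
  refine Finset.sum_subset (Finset.range_subset_range.2 (by omega)) fun j _ hj => ?_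
  rw [Finset.mem_range] at hj
  exact Finset.sum_eq_zero fun k _ => pT_zero _ _ _ (by omega)

lemma qPhat_eq : ∀ n : ℕ, qPhat (n + 1) = pS (n + 1) (n + 1) n
  | 0 => by simp [qPhat, pS, pT, qbinom]
  | 1 => by simp [qPhat, pS, pT, qbinom, Finset.sum_range_succ]
  | n + 2 => by
    rw [pS_rec, pS_stable (n + 2 + 1) _ _ (by omega) (by omega),
      pS_stable (n + 2) _ (n + 1) (by omega) (by omega),
      pS_stable (n + 2) _ n (by omega) (by omega), qPhat, qPhat_eq (n + 1), qPhat_eq n,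
      pS_stable _ _ (n + 1) (by omega) (by omega), pS_stable _ _ n (by omega) (by omega)]
    ring

lemma exp_eq (j k : ℕ) :
    (j ^ 2 + j + k ^ 2 + k) / 2 = (j + 1).choose 2 + (k + 1).choose 2 := by
  have h : ∀ m : ℕ, m ^ 2 + m = 2 * (m + 1).choose 2 := by
    intro m
    induction m with
    | zero => simp
    | succ m ih => rw [ch2 (m + 1)]; linarith
  have h1 := h j
  have h2 := h k
  omega

/-- For n ≥ 0, P̂_{n+1}(q) = Σ_{j=0}^n Σ_{k=0}^j q^((j²+j+k²+k)/2) [j choose k]_q [n−k choose j]_q. -/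
theorem qPellHat_double_sum_formula (n : ℕ) :
    qPhat (n + 1) = ∑ j ∈ Finset.range (n + 1), ∑ k ∈ Finset.range (j + 1),
      X ^ ((j ^ 2 + j + k ^ 2 + k) / 2) * qbinom j k * qbinom (n - k) j := by
  rw [qPhat_eq, pS_stable _ _ _ (by omega) (by omega)]
  simp only [exp_eq, pT]
end

section
/- For every integer n ≥ 0, P̂_{n+1}(q²) = Σ_{j ∈ ℤ} (−1)^j q^{4j²+2j} · T₁(n+1, 4j+1, q) in ℤ[q], where P̂_{n+1}(q²) denotes the polynomial P̂_{n+1} with q² substituted for q, and the sum has only finitely many nonzero terms since T₁(n+1, 4j+1, q) = 0 for |j| large. -/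
open Polynomial

section PellAux

variable {K : Type*} [Field K]

noncomputable def pG (q : K) : ℕ → ℤ → K
  | 0, m => if m = 0 then 1 else 0
  | n + 1, m => q ^ m * pG q n m + pG q n (m - 1)

theorem pG_neg (q : K) (n : ℕ) : ∀ m : ℤ, m < 0 → pG q n m = 0 := by
  induction n with
  | zero => intro m hm; simp [pG, hm.ne]
  | succ n ih => intro m hm; simp [pG, ih m hm, ih (m-1) (by omega)]

theorem pG_gt (q : K) (n : ℕ) : ∀ m : ℤ, (n:ℤ) < m → pG q n m = 0 := by
  induction n with
  | zero => intro m hm; simp only [pG]; rw [if_neg]; push_cast at hm; omega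
  | succ n ih =>
    intro m hm
    push_cast at hm
    simp [pG, ih m (by omega), ih (m-1) (by omega)]

theorem pG_zero (q : K) (n : ℕ) : pG q n 0 = 1 := by
  induction n with
  | zero => simp [pG]
  | succ n ih => simp [pG, ih, pG_neg]

theorem pG_p1 (q : K) (n : ℕ) (m : ℤ) :
    pG q (n+1) m = q ^ m * pG q n m + pG q n (m - 1) := rfl

theorem pG_p2 (q : K) (hq : q ≠ 0) (n : ℕ) : ∀ m : ℤ,
    pG q (n+1) m = pG q n m + q ^ ((n:ℤ) + 1 - m) * pG q n (m - 1) := by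
  induction n with
  | zero =>
    intro m
    simp only [pG]
    by_cases h : m = 0
    · subst h; simp
    · by_cases h1 : m = 1
      · subst h1; simp
      · have : m - 1 ≠ 0 := by omega
        simp [h, this]
  | succ n ih =>
    intro m
    rw [pG_p1 q (n+1) m]
    conv_rhs => rw [pG_p1 q n m, pG_p1 q n (m-1)]
    rw [ih m, ih (m-1)]
    have e1 : q ^ m * q ^ ((n:ℤ) + 1 - m) = q ^ ((n:ℤ)+1) := by
      rw [← zpow_add₀ hq]; congr 1; ring
    have e2 : q ^ (((n+1:ℕ):ℤ) + 1 - m) * q ^ (m-1) = q ^ ((n:ℤ)+1) := by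
      rw [← zpow_add₀ hq]; congr 1; push_cast; ring
    have e3 : q ^ ((n:ℤ) + 1 - (m-1)) = q ^ (((n+1:ℕ):ℤ) + 1 - m) := by
      congr 1; push_cast; ring
    rw [e3]
    linear_combination pG q n (m-1) * e1 - pG q n (m-1) * e2

theorem pG_symm (q : K) (hq : q ≠ 0) (n : ℕ) : ∀ m : ℤ, pG q n ((n:ℤ) - m) = pG q n m := by
  induction n with
  | zero => intro m; simp [pG]
  | succ n ih =>
    intro m
    rw [pG_p2 q hq n m, pG_p1]
    have a1 : ((n+1:ℕ):ℤ) - m = (n:ℤ) - (m-1) := by push_cast; ring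
    have a2 : ((n+1:ℕ):ℤ) - m - 1 = (n:ℤ) - m := by push_cast; ring
    have a3 : ((n+1:ℕ):ℤ) - m = (n:ℤ) + 1 - m := by push_cast; ring
    rw [a2, ih, a1, ih, ← a1, a3]; ring

theorem pG_a (q : K) (hq : q ≠ 0) (n : ℕ) (m : ℤ) :
    (1 - q ^ m) * pG q (n+1) m = (1 - q ^ ((n:ℤ)+1)) * pG q n (m-1) := by
  have e1 : q ^ m * q ^ ((n:ℤ) + 1 - m) = q ^ ((n:ℤ)+1) := by
    rw [← zpow_add₀ hq]; congr 1; ring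
  linear_combination pG_p1 q n m - q^m * pG_p2 q hq n m - pG q n (m-1) * e1

theorem pG_b (q : K) (hq : q ≠ 0) (n : ℕ) (m : ℤ) :
    (1 - q ^ ((n:ℤ)+1-m)) * pG q (n+1) m = (1 - q ^ ((n:ℤ)+1)) * pG q n m := by
  have e1 : q ^ m * q ^ ((n:ℤ) + 1 - m) = q ^ ((n:ℤ)+1) := by
    rw [← zpow_add₀ hq]; congr 1; ring
  linear_combination pG_p2 q hq n m - q^((n:ℤ)+1-m) * pG_p1 q n m - pG q n m * e1

theorem pG_c (q : K) (hq : q ≠ 0) (n : ℕ) (m : ℤ) :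
    (1 - q ^ m) * pG q n m = (1 - q ^ ((n:ℤ)+1-m)) * pG q n (m-1) := by
  linear_combination pG_p1 q n m - pG_p2 q hq n m

noncomputable def pD (Q : K) (n : ℕ) (F : ℕ → ℕ → K) : K :=
  ∑ p ∈ Finset.HasAntidiagonal.antidiagonal n, pG Q n p.2 * F p.1 p.2

theorem pD_congr (Q : K) (n : ℕ) {F F' : ℕ → ℕ → K}
    (h : ∀ i j, i + j = n → F i j = F' i j) : pD Q n F = pD Q n F' := by
  refine Finset.sum_congr rfl fun p hp => ?_
  rw [h p.1 p.2 (Finset.HasAntidiagonal.mem_antidiagonal.1 hp)]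

theorem pD_add (Q : K) (n : ℕ) (F F' : ℕ → ℕ → K) :
    pD Q n (fun i j => F i j + F' i j) = pD Q n F + pD Q n F' := by
  simp only [pD, ← Finset.sum_add_distrib, mul_add]

theorem pD_smul (Q : K) (n : ℕ) (c : K) (F : ℕ → ℕ → K) :
    pD Q n (fun i j => c * F i j) = c * pD Q n F := by
  simp only [pD, Finset.mul_sum]
  exact Finset.sum_congr rfl fun p _ => by ring

theorem pD_split (Q : K) (n : ℕ) (a b : ℕ → ℕ → K)
    (F : ℕ → ℕ → K)
    (h : ∀ i j, i + j = n + 1 → pG Q (n+1) j = a i j * pG Q n j + b i j * pG Q n ((j:ℤ)-1)) :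
    pD Q (n+1) F = pD Q n (fun i j => a (i+1) j * F (i+1) j + b i (j+1) * F i (j+1)) := by
  rw [pD_add]
  have : pD Q (n+1) F = ∑ p ∈ Finset.HasAntidiagonal.antidiagonal (n+1), pG Q n p.2 * (a p.1 p.2 * F p.1 p.2)
     + ∑ p ∈ Finset.HasAntidiagonal.antidiagonal (n+1), pG Q n ((p.2:ℤ)-1) * (b p.1 p.2 * F p.1 p.2) := by
    rw [← Finset.sum_add_distrib]
    refine Finset.sum_congr rfl fun p hp => ?_
    rw [h p.1 p.2 (Finset.HasAntidiagonal.mem_antidiagonal.1 hp)]; ring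
  rw [this]
  congr 1
  · rw [Finset.Nat.sum_antidiagonal_succ]
    simp only
    rw [pG_gt Q n ((n+1:ℕ):ℤ) (by push_cast; omega)]
    simp [pD]
  · rw [Finset.Nat.sum_antidiagonal_succ']
    simp only
    rw [pG_neg Q n (((0:ℕ):ℤ)-1) (by norm_num)]
    simp [pD]

theorem pD_s1 (Q : K) (n : ℕ) (F : ℕ → ℕ → K) :
    pD Q (n+1) F = pD Q n (fun i j => Q ^ j * F (i+1) j + F i (j+1)) := by
  rw [pD_split Q n (fun _ j => Q ^ j) (fun _ _ => 1)]
  · simp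
  · intro i j _; rw [pG_p1]; simp

theorem pD_s2 (Q : K) (hQ : Q ≠ 0) (n : ℕ) (F : ℕ → ℕ → K) :
    pD Q (n+1) F = pD Q n (fun i j => F (i+1) j + Q ^ i * F i (j+1)) := by
  rw [pD_split Q n (fun _ j => 1) (fun i _ => Q ^ i)]
  · simp
  · intro i j h; rw [pG_p2 Q hQ]
    have : (n:ℤ) + 1 - j = i := by omega
    rw [this]; simp

theorem pD_t1 (Q : K) (hQ : Q ≠ 0) (n : ℕ) (F : ℕ → ℕ → K) :
    pD Q (n+1) (fun i j => (1 - Q ^ j) * F i j) =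
      (1 - Q ^ (n+1)) * pD Q n (fun i j => F i (j+1)) := by
  rw [← pD_smul]
  unfold pD
  rw [Finset.Nat.sum_antidiagonal_succ']
  simp only [pow_zero, sub_self, zero_mul, mul_zero, add_zero, zero_add]
  refine Finset.sum_congr rfl fun p _ => ?_
  have := pG_a Q hQ n ((p.2+1:ℕ):ℤ)
  have e : ((p.2+1:ℕ):ℤ) - 1 = p.2 := by push_cast; ring
  have e' : (n:ℤ) + 1 = ((n+1:ℕ):ℤ) := by push_cast; ring
  rw [e, e', zpow_natCast, zpow_natCast] at this
  linear_combination F p.1 (p.2+1) * this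

theorem pD_t2 (Q : K) (hQ : Q ≠ 0) (n : ℕ) (F : ℕ → ℕ → K) :
    pD Q (n+1) (fun i j => (1 - Q ^ i) * F i j) =
      (1 - Q ^ (n+1)) * pD Q n (fun i j => F (i+1) j) := by
  rw [← pD_smul]
  unfold pD
  rw [Finset.Nat.sum_antidiagonal_succ]
  simp only [pow_zero, sub_self, zero_mul, mul_zero, add_zero, zero_add]
  refine Finset.sum_congr rfl fun p hp => ?_
  have hp' := Finset.HasAntidiagonal.mem_antidiagonal.1 hp
  have := pG_b Q hQ n (p.2:ℤ)
  have e : (n:ℤ) + 1 - p.2 = ((p.1+1:ℕ):ℤ) := by push_cast; omega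
  have e' : (n:ℤ) + 1 = ((n+1:ℕ):ℤ) := by push_cast; ring
  rw [e, e', zpow_natCast, zpow_natCast] at this
  linear_combination F (p.1+1) p.2 * this

noncomputable def pT0 (q : K) (n : ℕ) (A : ℤ) : K :=
  pD (q^2) n (fun i j => (-1) ^ j * pG q (2*i) ((i:ℤ) - A))

noncomputable def pT1 (q : K) (n : ℕ) (A : ℤ) : K :=
  pD (q^2) n (fun i j => (-q) ^ j * pG q (2*i) ((i:ℤ) - A))

theorem pT0_symm (q : K) (hq : q ≠ 0) (n : ℕ) (A : ℤ) : pT0 q n (-A) = pT0 q n A := by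
  refine pD_congr _ _ fun i j _ => ?_
  rw [← pG_symm q hq (2*i) ((i:ℤ) - A)]
  congr 2; push_cast; ring

theorem pT0_gt (q : K) (n : ℕ) (A : ℤ) (h : (n:ℤ) < A) : pT0 q n A = 0 := by
  unfold pT0 pD
  refine Finset.sum_eq_zero fun p hp => ?_
  have hp' := Finset.HasAntidiagonal.mem_antidiagonal.1 hp
  simp only
  rw [pG_neg q _ _ (by omega)]; simp

theorem pT0_lt (q : K) (n : ℕ) (A : ℤ) (h : A < -(n:ℤ)) : pT0 q n A = 0 := by
  unfold pT0 pD
  refine Finset.sum_eq_zero fun p hp => ?_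
  have hp' := Finset.HasAntidiagonal.mem_antidiagonal.1 hp
  simp only
  rw [pG_gt q _ _ (by push_cast; omega)]; simp

theorem pT_key (q : K) (hq : q ≠ 0) (n : ℕ) (A : ℤ) :
    pT1 q n (A+1) = pT1 q n A - q ^ ((n:ℤ) - A) * pT0 q n A
      + q ^ ((n:ℤ) + A + 1) * pT0 q n (A+1) := by
  have : pT1 q n (A+1) + q ^ ((n:ℤ) - A) * pT0 q n A = pT1 q n A
      + q ^ ((n:ℤ) + A + 1) * pT0 q n (A+1) := by
    unfold pT0 pT1
    rw [← pD_smul, ← pD_smul, ← pD_add, ← pD_add]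
    refine pD_congr _ _ fun i j h => ?_
    have := pG_c q hq (2*i) ((i:ℤ)-A)
    have e : ((2*i:ℕ):ℤ) + 1 - ((i:ℤ) - A) = i + A + 1 := by push_cast; ring
    have e' : (i:ℤ) - A - 1 = i - (A+1) := by ring
    rw [e, e'] at this
    have e1 : q ^ ((n:ℤ) - A) = q ^ ((i:ℤ) - A) * q ^ j := by
      rw [← zpow_natCast q j, ← zpow_add₀ hq]; congr 1; omega
    have e2 : q ^ ((n:ℤ) + A + 1) = q ^ ((i:ℤ) + A + 1) * q ^ j := by
      rw [← zpow_natCast q j, ← zpow_add₀ hq]; congr 1; omega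
    have e3 : (-q) ^ j = (-1) ^ j * q ^ j := by rw [← mul_pow]; congr 1; ring
    rw [e1, e2, e3]
    linear_combination (-(-1)^j * q^j) * this
  linear_combination this

theorem pT1_rec (q : K) (hq : q ≠ 0) (n : ℕ) (A : ℤ) :
    pT1 q (n+1) A = pT1 q n A + q ^ ((n:ℤ) + 1 + A) * pT0 q n (A+1)
      + q ^ ((n:ℤ) + 1 - A) * pT0 q n (A-1) := by
  unfold pT1 pT0
  rw [pD_s2 _ (pow_ne_zero 2 hq), ← pD_smul, ← pD_smul, ← pD_add, ← pD_add]
  refine pD_congr _ _ fun i j h => ?_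
  have e1 : q ^ ((n:ℤ) + 1 + A) = q ^ ((i:ℤ) + A + 1) * q ^ j := by
    rw [← zpow_natCast q j, ← zpow_add₀ hq]; congr 1; omega
  have e2 : q ^ ((n:ℤ) + 1 - A) = q ^ ((i:ℤ) - A + 1) * q ^ j := by
    rw [← zpow_natCast q j, ← zpow_add₀ hq]; congr 1; omega
  have e3 : (-q) ^ j = (-1) ^ j * q ^ j := by rw [← mul_pow]; congr 1; ring
  have e4 : (-q) ^ (j+1) = -q * ((-1) ^ j * q ^ j) := by rw [pow_succ, e3]; ring
  rw [e1, e2, e3, e4]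
  have c1 : (i:ℤ) - (A+1) = (i - A) - 1 := by ring
  have c2 : (i:ℤ) - (A-1) = (i - A) + 1 := by ring
  have c3 : ((i+1:ℕ):ℤ) - A = (i - A) + 1 := by push_cast; ring
  have c4 : 2 * (i+1) = 2*i+1+1 := by ring
  rw [c1, c2, c3, c4, pG_p1 q (2*i+1), pG_p2 q hq (2*i), pG_p2 q hq (2*i)]
  have d1 : ((2*i:ℕ):ℤ) + 1 - (i - A + 1) = i + A := by push_cast; ring
  have d2 : ((2*i:ℕ):ℤ) + 1 - (i - A + 1 - 1) = i + A + 1 := by push_cast; ring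
  have d3 : (i:ℤ) - A + 1 - 1 = i - A := by ring
  rw [d1, d2, d3]
  have f : q ^ ((i:ℤ) - A + 1) * q ^ ((i:ℤ) + A) = q * (q^2)^i := by
    rw [← zpow_add₀ hq, ← pow_mul, ← pow_succ', ← zpow_natCast]; congr 1; push_cast; ring
  linear_combination (-1)^j * q^j * pG q (2*i) ((i:ℤ)-A) * f

theorem pS_s18 (q : K) (hq : q ≠ 0) (A : ℤ) (n : ℕ) :
    pD (q^2) n (fun i j => (-1) ^ j * ((q^2)^j * pG q (2*i+1) ((i:ℤ) - A + 1)
      - pG q (2*i) ((i:ℤ) - A) - pG q (2*i) ((i:ℤ) - A + 1))) = 0 := by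
  induction n with
  | zero =>
    simp only [pD, Finset.Nat.antidiagonal_zero, Finset.sum_singleton]
    rw [show 2 * 0 + 1 = 0 + 1 from rfl, pG_p2 q hq]
    simp only [pG]
    by_cases h : A = 0
    · subst h; simp
    · simp [h]
  | succ n ih =>
    have hQ : q^2 ≠ 0 := pow_ne_zero 2 hq
    have := pD_congr (q^2) (n+1) (F := (fun i j => (-1) ^ j * ((q^2)^j * pG q (2*i+1) ((i:ℤ) - A + 1)
      - pG q (2*i) ((i:ℤ) - A) - pG q (2*i) ((i:ℤ) - A + 1))))
      (F' := fun i j => (1 - (q^2)^j) * (-(-1)^j * (pG q (2*i) ((i:ℤ) - A)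
          + pG q (2*i) ((i:ℤ) - A + 1)))
        + (1 - (q^2)^i) * (-(-1)^j * (q^2)^j * pG q (2*i-1) ((i:ℤ)-A))) (by
      intro i j _
      have k : (1 - q ^ ((i:ℤ) - A + 1)) * pG q (2*i) ((i:ℤ) - A + 1)
          = (1 - (q^2)^i) * pG q (2*i-1) ((i:ℤ) - A) := by
        cases i with
        | zero =>
          simp only [pG, Nat.mul_zero, pow_zero, sub_self, zero_mul]
          by_cases h : ((0:ℕ):ℤ) - A + 1 = 0
          · rw [h]; simp
          · simp only [h, if_false, mul_zero]
        | succ i =>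
          have := pG_a q hq (2*i+1) (((i+1:ℕ):ℤ) - A + 1)
          rw [show 2 * (i+1) = 2*i+1+1 by ring, this]
          have z : q ^ (((2*i+1:ℕ):ℤ)+1) = (q^2)^(i+1) := by
            rw [← pow_mul, ← zpow_natCast]; congr 1
          rw [z, show ((i+1:ℕ):ℤ) - A + 1 - 1 = ((i+1:ℕ):ℤ) - A by ring]
          rfl
      have p := pG_p1 q (2*i) ((i:ℤ) - A + 1)
      rw [show (i:ℤ) - A + 1 - 1 = i - A by ring] at p
      rw [p]
      linear_combination -(-1)^j * (q^2)^j * k)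
    rw [this, pD_add, pD_t1 _ hQ, pD_t2 _ hQ, ← mul_add, ← pD_add]
    have : (1 - (q^2)^(n+1)) * (-1 * pD (q^2) n (fun i j => (-1) ^ j * ((q^2)^j * pG q (2*i+1) ((i:ℤ) - A + 1)
      - pG q (2*i) ((i:ℤ) - A) - pG q (2*i) ((i:ℤ) - A + 1)))) = 0 := by rw [ih]; simp
    rw [← this]
    congr 1
    rw [← pD_smul]
    refine pD_congr _ _ fun i j _ => ?_
    rw [show 2 * (i+1) - 1 = 2*i+1 by omega, show ((i+1:ℕ):ℤ) - A = i - A + 1 by push_cast; ring]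
    ring

theorem pT0_rec (q : K) (hq : q ≠ 0) (n : ℕ) (A : ℤ) :
    pT0 q (n+1) A = pT0 q n (A-1) + q ^ ((n:ℤ) + 1 + A) * pT1 q n A
      + q ^ (2 * ((n:ℤ) + 1 + A)) * pT0 q n (A+1) := by
  have S := pS_s18 q hq A n
  rw [← add_zero (pT0 q n (A-1) + q ^ ((n:ℤ) + 1 + A) * pT1 q n A
      + q ^ (2 * ((n:ℤ) + 1 + A)) * pT0 q n (A+1)), ← S]
  unfold pT1 pT0
  rw [pD_s1, ← pD_smul, ← pD_smul, ← pD_add, ← pD_add, ← pD_add]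
  refine pD_congr _ _ fun i j h => ?_
  have e1 : q ^ ((n:ℤ) + 1 + A) = q ^ ((i:ℤ) + A + 1) * q ^ j := by
    rw [← zpow_natCast q j, ← zpow_add₀ hq]; congr 1; omega
  have e2 : q ^ (2 * ((n:ℤ) + 1 + A)) = (q ^ ((i:ℤ) + A + 1) * q ^ j)^2 := by
    rw [← e1, ← zpow_natCast, ← zpow_mul]; congr 1; push_cast; ring
  have e3 : (-q) ^ j = (-1) ^ j * q ^ j := by rw [← mul_pow]; congr 1; ring
  rw [e1, e2, e3]
  have c1 : (i:ℤ) - (A+1) = (i - A) - 1 := by ring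
  have c2 : (i:ℤ) - (A-1) = (i - A) + 1 := by ring
  have c3 : ((i+1:ℕ):ℤ) - A = (i - A) + 1 := by push_cast; ring
  have c4 : 2 * (i+1) = 2*i+1+1 := by ring
  rw [c1, c2, c3, c4, pG_p2 q hq (2*i+1)]
  have d3 : (i:ℤ) - A + 1 - 1 = i - A := by ring
  have d1 : ((2*i+1:ℕ):ℤ) + 1 - (i - A + 1) = i + A + 1 := by push_cast; ring
  rw [d1, d3, pG_p2 q hq (2*i) ((i:ℤ)-A)]
  have d2 : ((2*i:ℕ):ℤ) + 1 - (i - A) = i + A + 1 := by push_cast; ring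
  rw [d2]
  have : (q^2)^j = (q^j)^2 := by rw [← pow_mul, ← pow_mul, mul_comm]
  rw [this]
  ring

theorem pT0_rec' (q : K) (hq : q ≠ 0) (n : ℕ) (A : ℤ) (h1 : pT1 q n (-A) = pT1 q n A) :
    pT0 q (n+1) A = pT0 q n (A+1) + q ^ ((n:ℤ) + 1 - A) * pT1 q n A
      + q ^ (2 * ((n:ℤ) + 1 - A)) * pT0 q n (A-1) := by
  rw [← pT0_symm q hq (n+1) A, pT0_rec q hq, h1, ← pT0_symm q hq n (A+1),
    ← pT0_symm q hq n (A-1)]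
  ring_nf

theorem pT1_symm (q : K) (hq : q ≠ 0) (n : ℕ) (A : ℤ) : pT1 q n (-A) = pT1 q n A := by
  refine pD_congr _ _ fun i j _ => ?_
  rw [← pG_symm q hq (2*i) ((i:ℤ) - A)]
  congr 2; push_cast; ring

theorem pT1_gt (q : K) (n : ℕ) (A : ℤ) (h : (n:ℤ) < A) : pT1 q n A = 0 := by
  unfold pT1 pD
  refine Finset.sum_eq_zero fun p hp => ?_
  have hp' := Finset.HasAntidiagonal.mem_antidiagonal.1 hp
  simp only
  rw [pG_neg q _ _ (by omega)]; simp

theorem pT1_lt (q : K) (n : ℕ) (A : ℤ) (h : A < -(n:ℤ)) : pT1 q n A = 0 := by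
  unfold pT1 pD
  refine Finset.sum_eq_zero fun p hp => ?_
  have hp' := Finset.HasAntidiagonal.mem_antidiagonal.1 hp
  simp only
  rw [pG_gt q _ _ (by push_cast; omega)]; simp

noncomputable def pH (q : K) (n : ℕ) (j : ℤ) : K :=
  q ^ (n+1) * ((-1) ^ j * q ^ (4*j^2-2*j) * pT0 q n (4*j-1))

theorem p_step (q : K) (hq : q ≠ 0) (n : ℕ) (j : ℤ) :
    (-1) ^ j * q ^ (4*j^2+2*j) * pT1 q (n+2) (4*j+1) =
    (1 + (q^2)^(n+1)) * ((-1) ^ j * q ^ (4*j^2+2*j) * pT1 q (n+1) (4*j+1))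
    + (q^2)^(n+1) * ((-1) ^ j * q ^ (4*j^2+2*j) * pT1 q n (4*j+1))
    + (pH q n j - pH q n (j+1)) := by
  have r1 := pT1_rec q hq (n+1) (4*j+1)
  have r2 := pT1_rec q hq n (4*j+1)
  have k1 := pT_key q hq n (4*j)
  have k2 := pT_key q hq n (4*j+1)
  have a := pT0_rec q hq n (4*j)
  have b := pT0_rec' q hq n (4*j+2) (pT1_symm q hq _ _)
  unfold pH
  rw [show 4*j+1+1 = 4*j+2 by ring] at *
  rw [show 4*j+1-1 = 4*j by ring] at *
  rw [show 4*j+2+1 = 4*j+3 by ring, show 4*j+2-1 = 4*j+1 by ring] at b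
  rw [show 4*(j+1)-1 = 4*j+3 by ring]
  have hy : q ^ (4*j) ≠ 0 := zpow_ne_zero _ hq
  have z1 : q ^ (4*j^2-2*j) = q ^ (4*j^2+2*j) / q^(4*j) := by
    rw [← zpow_sub₀ hq]; congr 1; ring
  have z2 : q ^ (4*(j+1)^2-2*(j+1)) = q ^ (4*j^2+2*j) * q^(4*j) * q^2 := by
    rw [← zpow_natCast, ← zpow_add₀ hq, ← zpow_add₀ hq]; congr 1; push_cast; ring
  have z3 : ((-1:K)) ^ (j+1) = -(-1)^j := by
    rw [zpow_add₀ (by norm_num)]; simp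
  have y1 : q ^ (((n+1:ℕ):ℤ) + 1 + (4*j+1)) = q^n * q^(4*j) * q^3 := by
    rw [← zpow_natCast, ← zpow_natCast, ← zpow_add₀ hq, ← zpow_add₀ hq]; congr 1; push_cast; ring
  have y2 : q ^ (((n+1:ℕ):ℤ) + 1 - (4*j+1)) = q^n * q / q^(4*j) := by
    rw [← pow_succ, ← zpow_natCast, ← zpow_sub₀ hq]; congr 1; push_cast; ring
  have y3 : q ^ ((n:ℤ) + 1 + (4*j+1)) = q^n * q^(4*j) * q^2 := by
    rw [← zpow_natCast, ← zpow_natCast, ← zpow_add₀ hq, ← zpow_add₀ hq]; congr 1; push_cast; ring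
  have y4 : q ^ ((n:ℤ) + 1 - (4*j+1)) = q^n / q^(4*j) := by
    rw [← zpow_natCast, ← zpow_sub₀ hq]; congr 1; ring
  have y5 : q ^ ((n:ℤ) - 4*j) = q^n / q^(4*j) := by
    rw [← zpow_natCast, ← zpow_sub₀ hq]
  have y6 : q ^ ((n:ℤ) + 4*j + 1) = q^n * q^(4*j) * q := by
    rw [zpow_add₀ hq, zpow_add₀ hq]; simp
  have y7 : q ^ ((n:ℤ) - (4*j+1)) = q^n / q^(4*j) / q := by
    rw [← y5, div_eq_mul_inv, ← zpow_sub_one₀ hq]; congr 1; ring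
  have y8 : q ^ ((n:ℤ) + (4*j+1) + 1) = q^n * q^(4*j) * q^2 := by
    rw [← y3]; congr 1; ring
  have y9 : q ^ ((n:ℤ) + 1 + 4*j) = q^n * q^(4*j) * q := by
    rw [← y6]; congr 1; ring
  have y10 : q ^ (2*((n:ℤ) + 1 + 4*j)) = (q^n * q^(4*j) * q)^2 := by
    rw [← y9, ← zpow_natCast, ← zpow_mul]; congr 1; push_cast; ring
  have y11 : q ^ ((n:ℤ) + 1 - (4*j+2)) = q^n / q^(4*j) / q := by
    rw [← y7]; congr 1; ring
  have y12 : q ^ (2*((n:ℤ) + 1 - (4*j+2))) = (q^n / q^(4*j) / q)^2 := by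
    rw [← y11, ← zpow_natCast, ← zpow_mul]; congr 1; push_cast; ring
  have y13 : (q^2)^(n+1) = (q^n*q)^2 := by rw [← pow_succ, ← pow_mul, ← pow_mul, mul_comm]
  rw [z1, z2, z3, y13, pow_succ q n]
  rw [y1, y2] at r1
  rw [y3, y4] at r2
  rw [y5, y6] at k1
  rw [y7, y8] at k2
  rw [y9, y10] at a
  rw [y11, y12] at b
  generalize q ^ (4*j) = y at *
  generalize q ^ (4*j^2+2*j) = w at *
  generalize (-1:K)^j = c at *
  generalize q^n = v at *
  rw [r1, a, b, r2, k2, k1]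
  field_simp
  ring

theorem pD_zero (Q : K) (F : ℕ → ℕ → K) : pD Q 0 F = F 0 0 := by
  simp [pD, pG]

noncomputable def pR (q : K) (N : ℕ) (n : ℕ) : K :=
  ∑ j ∈ Finset.Ico (-(N:ℤ)) N, (-1) ^ j * q ^ (4*j^2+2*j) * pT1 q n (4*j+1)

theorem p_tele (f : ℤ → K) (N : ℕ) :
    ∑ j ∈ Finset.Ico (-(N:ℤ)) N, (f j - f (j+1)) = f (-N) - f N := by
  have h := fun (a:ℤ) (k : ℕ) => (show ∑ j ∈ Finset.Ico a (a+k), (f j - f (j+1)) = f a - f (a+k) by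
    induction k with
    | zero => simp
    | succ k ih =>
      have : Finset.Ico a (a + ((k+1:ℕ):ℤ)) = insert (a+k) (Finset.Ico a (a+k)) := by
        ext x; simp only [Finset.mem_Ico, Finset.mem_insert]; push_cast; omega
      rw [this, Finset.sum_insert (by simp), ih]
      push_cast; rw [← add_assoc]; ring)
  have := h (-N) (2*N)
  rwa [show -(N:ℤ) + ((2*N:ℕ):ℤ) = N by push_cast; ring] at this

theorem pR_step (q : K) (hq : q ≠ 0) (N n : ℕ) (h : n + 2 ≤ N) :
    pR q N (n+2) = (1 + (q^2)^(n+1)) * pR q N (n+1) + (q^2)^(n+1) * pR q N n := by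
  unfold pR
  rw [Finset.sum_congr rfl fun j _ => p_step q hq n j, Finset.sum_add_distrib,
    Finset.sum_add_distrib, ← Finset.mul_sum, ← Finset.mul_sum, p_tele]
  unfold pH
  rw [pT0_gt q n (4*N-1) (by omega), pT0_lt q n (4*(-N)-1) (by omega)]
  ring

theorem pR_zero (q : K) (N : ℕ) : pR q N 0 = 0 := by
  refine Finset.sum_eq_zero fun j _ => ?_
  rw [pT1, pD_zero]
  simp only [pG, Nat.mul_zero]
  rw [if_neg (by push_cast; omega)]; simp

theorem pR_one (q : K) (hq : q ≠ 0) (N : ℕ) (h : 1 ≤ N) : pR q N 1 = 1 := by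
  unfold pR
  rw [Finset.sum_eq_single 0]
  · rw [pT1_rec q hq 0, pT1, pT0, pT0, pD_zero, pD_zero, pD_zero]
    simp [pG]
  · intro j _ hj
    rw [pT1_rec q hq 0, pT1, pT0, pT0, pD_zero, pD_zero, pD_zero]
    simp only [pG, Nat.mul_zero]
    rw [if_neg (by push_cast; omega), if_neg (by push_cast; omega), if_neg (by push_cast; omega)]
    simp
  · intro h0; exfalso; apply h0; simp; omega

theorem p_phat (q : K) (hq : q ≠ 0) (ψ : Polynomial ℤ →+* K) (hψ : ψ X = q^2) (N : ℕ) :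
    ∀ n, (n ≤ N → ψ (qPhat n) = pR q N n) ∧ (n + 1 ≤ N → ψ (qPhat (n+1)) = pR q N (n+1)) := by
  intro n
  induction n with
  | zero =>
    constructor
    · intro _; simp [qPhat, pR_zero]
    · intro h; rw [pR_one q hq N h]; simp [qPhat]
  | succ n ih =>
    refine ⟨ih.2, fun h => ?_⟩
    rw [pR_step q hq N n h, qPhat, ← ih.1 (by omega), ← ih.2 (by omega)]
    simp [hψ]

theorem p_qbinom (q : K) (ψ : Polynomial ℤ →+* K) (hψ : ψ X = q) (n : ℕ) :
    ∀ m : ℕ, ψ (qbinom n m) = pG q n m := by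
  induction n with
  | zero =>
    intro m
    cases m with
    | zero => simp [qbinom, pG]
    | succ m => simp only [qbinom, pG]; rw [if_neg (by push_cast; omega)]; simp
  | succ n ih =>
    intro m
    cases m with
    | zero => rw [Nat.cast_zero, pG_zero]; simp [qbinom]
    | succ m =>
      rw [pG_p1, qbinom, zpow_natCast, ← ih, show ((m+1:ℕ):ℤ) - 1 = m by push_cast; ring, ← ih]
      simp [hψ]

theorem p_qbinomZ (q : K) (ψ : Polynomial ℤ →+* K) (hψ : ψ X = q) (n : ℕ) (m : ℤ) :
    ψ (qbinomZ n m) = pG q n m := by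
  unfold qbinomZ
  split_ifs with h
  · rw [p_qbinom q ψ hψ, Int.toNat_of_nonneg h]
  · rw [pG_neg q n m (by omega)]; simp

theorem p_qT1 (q : K) (ψ : Polynomial ℤ →+* K) (hψ : ψ X = q) (n : ℕ) (m : ℤ) :
    ψ (qT1 n m) = pT1 q n m := by
  unfold qT1 pT1 pD
  rw [← Finset.Nat.sum_antidiagonal_swap, Finset.Nat.sum_antidiagonal_eq_sum_range_succ_mk, map_sum]
  refine Finset.sum_congr rfl fun j hj => ?_
  have hj' : j ≤ n := by simpa [Nat.lt_succ_iff] using hj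
  have := p_qbinom (q^2) (ψ.comp (Polynomial.compRingHom (X^2))) (by simp [hψ]) n j
  simp only [RingHom.comp_apply, Polynomial.coe_compRingHom] at this
  simp only [Prod.swap]
  rw [map_mul, map_mul, this, p_qbinomZ q ψ hψ, map_pow, map_neg, hψ, ← Nat.mul_sub]
  rw [show (n:ℤ) - m - j = ((n-j:ℕ):ℤ) - m by omega]
  ring

end PellAux

/-- For n ≥ 0, P̂_{n+1}(q²) = Σ_{j ∈ ℤ} (−1)^j q^(4j²+2j) T₁(n+1, 4j+1, q),
the sum having finitely many nonzero terms. -/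
theorem qPellHat_T1_formula (n : ℕ) :
    (qPhat (n + 1)).comp (X ^ 2) =
      ∑ᶠ j : ℤ, C ((j.negOnePow : ℤˣ) : ℤ) * X ^ (4 * j ^ 2 + 2 * j).toNat *
        qT1 (n + 1) (4 * j + 1) := by
  let φ : Polynomial ℤ →+* FractionRing (Polynomial ℤ) := algebraMap _ _
  have hφ : Function.Injective φ := IsFractionRing.injective _ _
  have hq : φ X ≠ 0 := fun h => Polynomial.X_ne_zero (hφ (h.trans (map_zero φ).symm))
  rw [finsum_eq_sum_of_support_subset (s := Finset.Ico (-((n+1:ℕ):ℤ)) ((n+1:ℕ):ℤ))]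
  · apply hφ
    have := (p_phat (φ X) hq (φ.comp (Polynomial.compRingHom (X^2))) (by simp) (n+1) n).2 le_rfl
    simp only [RingHom.comp_apply, Polynomial.coe_compRingHom] at this
    rw [this, pR, map_sum]
    refine Finset.sum_congr rfl fun j _ => ?_
    rw [map_mul, map_mul, p_qT1 (φ X) φ rfl, map_pow]
    have h0 : 0 ≤ 4 * j ^ 2 + 2 * j := by
      rcases lt_or_ge j 0 with h | h <;> nlinarith
    congr 2
    · rcases Int.even_or_odd j with h | h
      · rw [Int.negOnePow_even j h, h.neg_one_zpow]; simp
      · rw [Int.negOnePow_odd j h, h.neg_one_zpow]; simp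
    · rw [← zpow_natCast, Int.toNat_of_nonneg h0]
  · intro j hj
    by_contra hc
    apply hj
    have hz : qT1 (n+1) (4*j+1) = 0 := by
      apply hφ
      rw [p_qT1 (φ X) φ rfl, map_zero]
      simp only [Finset.coe_Ico, Set.mem_Ico, not_and_or, not_le, not_lt] at hc
      rcases hc with h | h
      · exact pT1_lt _ _ _ (by omega)
      · exact pT1_gt _ _ _ (by omega)
    simp only [hz, mul_zero]
end
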